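/- arXiv:2504.13753 — 2 statements merged into one kernel-verified Lean document; each statement's English description precedes it below -/
import Mathlib

section
/- For every multi-index ν, the sum over all multi-indices η with 0 ≤ η ≤ ν of (ν choose η) · [1/2]_{|η|} · [1/2]_{|ν−η|} is at most 4 · [1/2]_{|ν|}. -/
/-- The absolute falling factorial `[1/2]_n`: `[1/2]_0 = 1`, and
`[1/2]_{n+1} = |n - 1/2| * [1/2]_n`, so that `[1/2]_1 = 1/2`. -/
noncomputable def gd : ℕ → ℝ
  | 0 => 1
  | n + 1 => |(n : ℝ) - 1 / 2| * gd n

/-- The total degree `|ν| = Σ_j ν_j` of a multi-index. -/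
def deg (ν : ℕ →₀ ℕ) : ℕ := ν.sum fun _ n => n

/-- The multi-index binomial coefficient `(ν choose η) = Π_j (ν_j choose η_j)`. -/
def mchoose (ν η : ℕ →₀ ℕ) : ℕ := ∏ j ∈ ν.support ∪ η.support, (ν j).choose (η j)

noncomputable def hh : ℕ → ℝ
  | 0 => 1
  | n + 1 => ((n : ℝ) - 1 / 2) * hh n

lemma gd_succ (n : ℕ) : gd (n + 1) = - hh (n + 1) := by
  induction n with
  | zero => norm_num [gd, hh, abs_of_neg]
  | succ k ih =>
    rw [gd, hh, ih, abs_of_nonneg]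
    · ring
    · push_cast
      have : (0 : ℝ) ≤ k := Nat.cast_nonneg k
      linarith

lemma gd_eq (n : ℕ) : gd n = (if n = 0 then 2 else 0) - hh n := by
  cases n with
  | zero => norm_num [gd, hh]
  | succ k => simp [gd_succ]

lemma hh_conv_succ (n : ℕ) :
    ∑ ij ∈ Finset.HasAntidiagonal.antidiagonal (n + 1), ((n + 1).choose ij.1 : ℝ) * (hh ij.1 * hh ij.2) =
      ((n : ℝ) - 1) * ∑ ij ∈ Finset.HasAntidiagonal.antidiagonal n, (n.choose ij.1 : ℝ) * (hh ij.1 * hh ij.2) := by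
  rw [Finset.sum_antidiagonal_choose_succ_mul (fun i j => hh i * hh j), ← Finset.sum_add_distrib,
    Finset.mul_sum]
  refine Finset.sum_congr rfl fun ij hij => ?_
  have h := Finset.HasAntidiagonal.mem_antidiagonal.1 hij
  rw [Nat.choose_symm_of_eq_add h.symm]
  subst h
  simp only [hh]
  push_cast
  ring

lemma hh_conv (n : ℕ) :
    ∑ ij ∈ Finset.HasAntidiagonal.antidiagonal (n + 2), ((n + 2).choose ij.1 : ℝ) * (hh ij.1 * hh ij.2) = 0 := by
  induction n with
  | zero => rw [hh_conv_succ]; simp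
  | succ k ih => rw [hh_conv_succ, ih, mul_zero]

lemma gd_nonneg (n : ℕ) : 0 ≤ gd n := by
  induction n with
  | zero => simp [gd]
  | succ k ih => rw [gd]; positivity

lemma gd_conv (n : ℕ) :
    ∑ k ∈ Finset.range (n + 1), (n.choose k : ℝ) * gd k * gd (n - k) ≤ 4 * gd n := by
  match n with
  | 0 => norm_num [gd]
  | 1 => norm_num [gd, Finset.sum_range_succ, abs_of_neg]
  | m + 2 =>
    have h := hh_conv m
    rw [Finset.Nat.sum_antidiagonal_eq_sum_range_succ_mk, Finset.sum_range_succ,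
      Finset.sum_range_succ'] at h
    rw [Finset.sum_range_succ, Finset.sum_range_succ']
    have e : ∀ k ∈ Finset.range (m + 1),
        ((m + 2).choose (k + 1) : ℝ) * gd (k + 1) * gd (m + 2 - (k + 1)) =
        ((m + 2).choose (k + 1) : ℝ) * (hh (k + 1) * hh (m + 2 - (k + 1))) := by
      intro k hk
      obtain ⟨j, hj⟩ : ∃ j, m + 2 - (k + 1) = j + 1 :=
        ⟨m - k, by have := Finset.mem_range.1 hk; omega⟩
      rw [hj, gd_succ, gd_succ]
      ring
    rw [Finset.sum_congr rfl e]
    have h2 : gd (m + 2) = - hh (m + 2) := gd_succ _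
    have h0 : hh 0 = 1 := rfl
    have g0 : gd 0 = 1 := rfl
    simp only [Nat.choose_zero_right, Nat.choose_self, Nat.sub_self, Nat.sub_zero, h0, g0,
      Nat.cast_one] at h ⊢
    rw [h2]
    linarith

lemma deg_eq {ν η : ℕ →₀ ℕ} (h : η ≤ ν) : deg η = ∑ j ∈ ν.support, η j :=
  Finsupp.sum_of_support_subset _ (Finsupp.support_mono h) _ (by simp)

lemma mchoose_eq {ν η : ℕ →₀ ℕ} (h : η ≤ ν) :
    mchoose ν η = ∏ j ∈ ν.support, (ν j).choose (η j) := by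
  rw [mchoose, Finset.union_eq_left.2 (Finsupp.support_mono h)]

open Polynomial in
lemma poly_id (ν : ℕ →₀ ℕ) :
    ∑ η ∈ Finset.Icc 0 ν, (C (mchoose ν η : ℝ)) * X ^ (deg η) = ((X : ℝ[X]) + 1) ^ (deg ν) := by
  classical
  have h1 : ((X : ℝ[X]) + 1) ^ (deg ν) =
      ∏ j ∈ ν.support, ∑ i ∈ Finset.Icc 0 (ν j), C ((ν j).choose i : ℝ) * X ^ i := by
    rw [deg_eq le_rfl, ← Finset.prod_pow_eq_pow_sum]
    refine Finset.prod_congr rfl fun j _ => ?_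
    rw [add_pow, Nat.range_succ_eq_Icc_zero]
    refine Finset.sum_congr rfl fun i _ => ?_
    simp [mul_comm]
  have h2 : ∑ η ∈ Finset.Icc 0 ν, (C (mchoose ν η : ℝ)) * X ^ (deg η) =
      ∑ η ∈ Finset.Icc 0 ν, ∏ j ∈ ν.support, (C ((ν j).choose (η j) : ℝ) * X ^ (η j)) := by
    refine Finset.sum_congr rfl fun η hη => ?_
    have h := (Finset.mem_Icc.1 hη).2
    rw [mchoose_eq h, deg_eq h, Finset.prod_mul_distrib, Finset.prod_pow_eq_pow_sum]
    simp
  rw [h1, h2, Finset.prod_sum]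
  symm
  refine Finset.sum_bij' (fun p _ => Finsupp.indicator ν.support p) (fun η _ j _ => η j)
    ?_ ?_ ?_ ?_ ?_
  · intro p hp
    rw [Finset.mem_Icc]
    refine ⟨zero_le, fun j => ?_⟩
    rw [Finsupp.indicator_apply]
    split_ifs with hj
    · exact (Finset.mem_Icc.1 (Finset.mem_pi.1 hp j hj)).2
    · exact Nat.zero_le _
  · intro η hη
    rw [Finset.mem_pi]
    intro j _
    exact Finset.mem_Icc.2 ⟨Nat.zero_le _, (Finset.mem_Icc.1 hη).2 j⟩
  · intro p hp
    funext j hj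
    exact Finsupp.indicator_of_mem hj _
  · intro η hη
    ext j
    rw [Finsupp.indicator_apply]
    split_ifs with hj
    · rfl
    · have := (Finset.mem_Icc.1 hη).2 j
      rw [Finsupp.notMem_support_iff.1 hj] at this
      omega
  · intro p hp
    rw [← Finset.prod_attach ν.support]
    refine Finset.prod_congr rfl fun j _ => ?_
    rw [Finsupp.indicator_of_mem j.2]

lemma coeff_id (ν : ℕ →₀ ℕ) (k : ℕ) :
    ∑ η ∈ Finset.Icc 0 ν, (if k = deg η then (mchoose ν η : ℝ) else 0) = (deg ν).choose k := by
  have h := congrArg (fun p => Polynomial.coeff p k) (poly_id ν)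
  simp only [Polynomial.finsetSum_coeff, Polynomial.coeff_C_mul_X_pow,
    Polynomial.coeff_X_add_one_pow] at h
  exact h

theorem stmt3 (ν : ℕ →₀ ℕ) :
    ∑ η ∈ Finset.Icc 0 ν, (mchoose ν η : ℝ) * gd (deg η) * gd (deg (ν - η))
      ≤ 4 * gd (deg ν) := by
  have key : ∑ η ∈ Finset.Icc 0 ν, (mchoose ν η : ℝ) * gd (deg η) * gd (deg (ν - η)) =
      ∑ k ∈ Finset.range (deg ν + 1), ((deg ν).choose k : ℝ) * gd k * gd (deg ν - k) := by
    simp_rw [← coeff_id ν, Finset.sum_mul]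
    rw [Finset.sum_comm]
    refine Finset.sum_congr rfl fun η hη => ?_
    have h := (Finset.mem_Icc.1 hη).2
    have hadd : deg η + deg (ν - η) = deg ν := by
      rw [deg_eq h, deg_eq (tsub_le_self : ν - η ≤ ν), deg_eq (le_refl ν),
        ← Finset.sum_add_distrib]
      refine Finset.sum_congr rfl fun j _ => ?_
      have := h j
      rw [Finsupp.tsub_apply]
      omega
    rw [Finset.sum_eq_single (deg η)]
    · rw [if_pos rfl, ← hadd, Nat.add_sub_cancel_left]
    · intro k _ hk
      rw [if_neg hk]; simp
    · intro hk
      exact absurd (Finset.mem_range.2 (by omega)) hk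
  rw [key]
  exact gd_conv _
end

section
/- Let d ≥ 1 and n ≥ 1 be natural numbers and let ν be a nonzero multi-index supported in {1, …, n}. Then Σ_{λ ∈ ℕ^d, 1 ≤ |λ| ≤ |ν|} |λ|! · Σ_{s=1}^{|ν|} Σ_{((k_j), (ℓ_j)) ∈ P_s(ν,λ)} ν! · Π_{j=1}^s (|ℓ_j|!)^{|k_j|} / (k_j! · (ℓ_j!)^{|k_j|}) = d · (d+1)^{|ν|−1} · |ν|!, as an identity of rational numbers. -/
/-- The weight `|x| = Σ_i x_i` of a tuple of natural numbers. -/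
def wt {m : ℕ} (x : Fin m → ℕ) : ℕ := ∑ i, x i

/-- The multi-index factorial `x! = Π_i (x_i!)`. -/
def fct {m : ℕ} (x : Fin m → ℕ) : ℕ := ∏ i, (x i).factorial

/-- The linear order `≺` on multi-indices: `l ≺ ν` iff `|l| < |ν|`, or `|l| = |ν|`
and `l` is lexicographically smaller than `ν` (they agree up to some index `k` and
`l k < ν k`). -/
def mlt {m : ℕ} (l ν : Fin m → ℕ) : Prop :=
  wt l < wt ν ∨ (wt l = wt ν ∧ ∃ k : Fin m, (∀ i, i < k → l i = ν i) ∧ l k < ν k)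

/-- The index set `P_s(ν, λ)` of the multivariate Faà di Bruno formula: pairs of
`s`-tuples `((k_j), (ℓ_j))` with `k_j ∈ ℕ^d`, `|k_j| > 0`, `Σ_j k_j = λ`,
`0 ≺ ℓ_1 ≺ ⋯ ≺ ℓ_s`, and `Σ_j |k_j| · ℓ_j = ν`. -/
def PsSet (n d s : ℕ) (ν : Fin n → ℕ) (lam : Fin d → ℕ) :
    Set ((Fin s → Fin d → ℕ) × (Fin s → Fin n → ℕ)) :=
  {p | (∀ j, 0 < wt (p.1 j)) ∧ (∑ j, p.1 j) = lam ∧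
       (∀ j, mlt 0 (p.2 j)) ∧ (∀ j j' : Fin s, j < j' → mlt (p.2 j) (p.2 j')) ∧
       (∑ j, wt (p.1 j) • p.2 j) = ν}

noncomputable section AA
open Finset

lemma polyA (d : ℚ) (M : ℕ) (hM : 1 ≤ M) :
    (∑ N ∈ Icc 1 M, (Polynomial.C d * ∑ m ∈ Icc 1 M, (Polynomial.X : Polynomial ℚ) ^ m) ^ N).coeff M
      = d * (d + 1) ^ (M - 1) := by
  set A : Polynomial ℚ := ∑ m ∈ Icc 1 M, (Polynomial.X : Polynomial ℚ) ^ m with hA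
  set A' : Polynomial ℚ := ∑ m ∈ range M, (Polynomial.X : Polynomial ℚ) ^ m with hA'
  have hI : ∀ f : ℕ → Polynomial ℚ, ∑ m ∈ Icc 1 M, f m = ∑ m ∈ range M, f (m + 1) := by
    intro f
    rw [Finset.range_eq_Ico, Finset.sum_Ico_add' f 0 M 1]
    rfl
  have h1 : A = Polynomial.X * A' := by
    rw [hA, hI, hA', Finset.mul_sum]
    exact Finset.sum_congr rfl fun m _ => by ring
  have h2 : A' * (1 - Polynomial.X) = 1 - Polynomial.X ^ M := geom_sum_mul_neg _ _
  set B : Polynomial ℚ := ∑ N ∈ range (M + 1), (Polynomial.C d * A) ^ N with hB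
  have h3 : B * (1 - Polynomial.C d * A) = 1 - (Polynomial.C d * A) ^ (M + 1) := geom_sum_mul_neg _ _
  have hBp : B = (∑ N ∈ Icc 1 M, (Polynomial.C d * A) ^ N) + 1 := by
    rw [hB, hI, Finset.sum_range_succ']; simp
  obtain ⟨R, hR⟩ : ∃ R, B * (1 - Polynomial.C (d + 1) * Polynomial.X) = 1 - Polynomial.X + R * Polynomial.X ^ (M + 1) := by
    refine ⟨-(1 - Polynomial.X) * (Polynomial.C d * A') ^ (M + 1) - Polynomial.C d * B, ?_⟩
    have e : (Polynomial.C d * A) ^ (M + 1) = (Polynomial.C d * A') ^ (M + 1) * Polynomial.X ^ (M + 1) := by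
      rw [h1, ← mul_pow]; ring
    rw [e] at h3
    rw [h1] at h3
    simp only [map_add, map_one]
    linear_combination (1 - Polynomial.X) * h3 + B * Polynomial.C d * Polynomial.X * h2
  have hc : ∀ k, k < M → B.coeff (k + 1) = (d + 1) * B.coeff k - (if k = 0 then 1 else 0) := by
    intro k hk
    have := congrArg (fun p => Polynomial.coeff p (k + 1)) hR
    have e : B * (1 - Polynomial.C (d + 1) * Polynomial.X) = B - Polynomial.C (d + 1) * (B * Polynomial.X) := by ring
    simp only [e, Polynomial.coeff_sub, Polynomial.coeff_C_mul, Polynomial.coeff_mul_X,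
      Polynomial.coeff_add, Polynomial.coeff_mul_X_pow', Polynomial.coeff_one, Polynomial.coeff_X] at this
    rw [if_neg (by omega), if_neg (show ¬ (M + 1 ≤ k + 1) by omega)] at this
    rcases k with _ | k
    · simp at this ⊢; linarith
    · simp at this ⊢; linarith
  have h0 : B.coeff 0 = 1 := by
    have := congrArg (fun p => Polynomial.coeff p 0) hR
    simpa [Polynomial.mul_coeff_zero] using this
  have hk : ∀ k, k < M → B.coeff (k + 1) = d * (d + 1) ^ k := by
    intro k
    induction k with
    | zero => intro h; rw [hc 0 h, h0]; simp
    | succ k ih => intro h; rw [hc _ h, ih (by omega)]; simp; ring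
  have := hk (M - 1) (by omega)
  rw [show M - 1 + 1 = M by omega, hBp, Polynomial.coeff_add, Polynomial.coeff_one, if_neg (by omega), add_zero] at this
  exact this

abbrev ee {n : ℕ} (l : Fin n → ℕ) : Fin n →₀ ℕ := Finsupp.equivFunOnFinite.symm l

def cc {n : ℕ} (l : Fin n → ℕ) : ℚ := ((wt l).factorial : ℚ) / fct l

lemma fct_ne {n : ℕ} (l : Fin n → ℕ) : (fct l : ℚ) ≠ 0 := by
  unfold fct
  exact_mod_cast Finset.prod_ne_zero_iff.2 fun i _ => Nat.factorial_ne_zero _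

lemma multi_eq {ι : Type*} (s : Finset ι) (k : ι → ℕ) :
    (Nat.multinomial s k : ℚ) = ((∑ i ∈ s, k i).factorial : ℚ) / ∏ i ∈ s, ((k i).factorial : ℚ) := by
  rw [eq_div_iff, ← Nat.multinomial_spec s k]
  · push_cast; ring
  · exact Finset.prod_ne_zero_iff.2 fun i _ => by exact_mod_cast Nat.factorial_ne_zero _

lemma prod_mono {n : ℕ} {ι : Type*} (s : Finset ι) (f : ι → (Fin n →₀ ℕ)) (c : ι → ℚ) (k : ι → ℕ) :
    ∏ i ∈ s, (MvPolynomial.monomial (f i) (c i)) ^ (k i)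
      = MvPolynomial.monomial (∑ i ∈ s, k i • f i) (∏ i ∈ s, c i ^ k i) := by
  classical
  induction s using Finset.induction_on with
  | empty => simp
  | insert a s ha ih =>
    rw [Finset.prod_insert ha, Finset.sum_insert ha, Finset.prod_insert ha, ih,
      MvPolynomial.monomial_pow, MvPolynomial.monomial_mul]

def uu (n : ℕ) : MvPolynomial (Fin n) ℚ := ∑ i, MvPolynomial.X i

lemma uu_pow (n m : ℕ) : uu n ^ m = ∑ l ∈ piAntidiag univ m, MvPolynomial.monomial (ee l) (cc l) := by
  unfold uu
  rw [Finset.sum_pow_eq_sum_piAntidiag]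
  refine Finset.sum_congr rfl fun l hl => ?_
  simp only [MvPolynomial.X]
  rw [prod_mono]
  have : ∑ i, l i • (Finsupp.single i 1 : Fin n →₀ ℕ) = ee l := by
    ext j; simp [Finsupp.single_apply, Finsupp.finsetSum_apply]
  rw [this]
  rw [show ((Nat.multinomial univ l : ℕ) : MvPolynomial (Fin n) ℚ) = MvPolynomial.C (Nat.multinomial univ l : ℚ) by simp]
  rw [MvPolynomial.C_mul_monomial, multi_eq]
  simp [cc, wt, fct]

lemma coeff_uu (n m : ℕ) (ν : Fin n → ℕ) :
    MvPolynomial.coeff (ee ν) (uu n ^ m) = if wt ν = m then cc ν else 0 := by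
  classical
  rw [uu_pow, MvPolynomial.coeff_sum]
  simp only [MvPolynomial.coeff_monomial, EmbeddingLike.apply_eq_iff_eq]
  rw [Finset.sum_ite_eq']
  simp only [mem_piAntidiag, wt]
  simp
  rfl

lemma coeff_aeval (n : ℕ) (ν : Fin n → ℕ) (p : Polynomial ℚ) :
    MvPolynomial.coeff (ee ν) (Polynomial.aeval (uu n) p) = p.coeff (wt ν) * cc ν := by
  rw [Polynomial.aeval_eq_sum_range, MvPolynomial.coeff_sum]
  simp only [MvPolynomial.coeff_smul, coeff_uu, smul_eq_mul, mul_ite, mul_zero]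
  rw [Finset.sum_ite_eq]
  split_ifs with h
  · rfl
  · rw [Polynomial.coeff_eq_zero_of_natDegree_lt (by simpa using h), zero_mul]

def LL (n M : ℕ) : Finset (Fin n → ℕ) := (Icc 1 M).biUnion fun m => piAntidiag univ m

lemma mem_LL {n M : ℕ} {l : Fin n → ℕ} : l ∈ LL n M ↔ 1 ≤ wt l ∧ wt l ≤ M := by
  simp [LL, wt]

lemma sum_LL {n M : ℕ} {β : Type*} [AddCommMonoid β] (f : (Fin n → ℕ) → β) :
    ∑ l ∈ LL n M, f l = ∑ m ∈ Icc 1 M, ∑ l ∈ piAntidiag univ m, f l := by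
  unfold LL
  rw [Finset.sum_biUnion]
  intro a _ b _ hab
  simp only [Function.onFun]
  rw [Finset.disjoint_left]
  intro l h1 h2
  simp at h1 h2
  omega

/-- The main generating function identity. -/
lemma gen (d n : ℕ) (ν : Fin n → ℕ) (hν : 1 ≤ wt ν) :
    MvPolynomial.coeff (ee ν) (∑ N ∈ Icc 1 (wt ν),
      (∑ q ∈ LL n (wt ν) ×ˢ (univ : Finset (Fin d)), MvPolynomial.monomial (ee q.1) (cc q.1)) ^ N)
    = (d : ℚ) * ((d : ℚ) + 1) ^ (wt ν - 1) * cc ν := by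
  rw [← polyA d (wt ν) hν, ← coeff_aeval]
  congr 1
  simp only [map_sum, map_pow, map_mul, Polynomial.aeval_C, Polynomial.aeval_X]
  refine Finset.sum_congr rfl fun N _ => ?_
  congr 1
  rw [Finset.sum_product]
  simp only [Finset.sum_const, Finset.card_univ, Fintype.card_fin]
  rw [← Finset.smul_sum, sum_LL]
  simp only [← uu_pow]
  simp

def KK (d n : ℕ) (ν : Fin n → ℕ) (N : ℕ) : Finset ((Fin n → ℕ) × Fin d → ℕ) :=
  {K ∈ piAntidiag (LL n (wt ν) ×ˢ (univ : Finset (Fin d))) N |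
    ∑ l ∈ LL n (wt ν), (wt fun i => K (l, i)) • l = ν}

lemma ee_sum {d n : ℕ} (L : Finset (Fin n → ℕ)) (K : (Fin n → ℕ) × Fin d → ℕ) :
    ∑ q ∈ L ×ˢ (univ : Finset (Fin d)), K q • ee q.1 = ee (∑ l ∈ L, (wt fun i => K (l, i)) • l) := by
  rw [Finset.sum_product]
  ext j
  simp [Finsupp.finsetSum_apply, wt, Finset.sum_mul]

lemma KK_sum (d n : ℕ) (ν : Fin n → ℕ) (N : ℕ) :
    ∑ K ∈ KK d n ν N, (N.factorial : ℚ) * ((fct ν : ℚ) * ∏ l ∈ LL n (wt ν),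
      (((wt l).factorial : ℚ) ^ (wt fun i => K (l, i)) /
        ((fct fun i => K (l, i) : ℚ) * (fct l : ℚ) ^ (wt fun i => K (l, i)))))
    = (fct ν : ℚ) * MvPolynomial.coeff (ee ν)
      ((∑ q ∈ LL n (wt ν) ×ˢ (univ : Finset (Fin d)), MvPolynomial.monomial (ee q.1) (cc q.1)) ^ N) := by
  classical
  rw [Finset.sum_pow_eq_sum_piAntidiag, MvPolynomial.coeff_sum, KK, Finset.sum_filter, Finset.mul_sum]
  refine Finset.sum_congr rfl fun K hK => ?_
  rw [Finset.mem_piAntidiag] at hK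
  rw [prod_mono]
  rw [show ((Nat.multinomial (LL n (wt ν) ×ˢ (univ : Finset (Fin d))) K : ℕ) : MvPolynomial (Fin n) ℚ) = MvPolynomial.C (Nat.multinomial (LL n (wt ν) ×ˢ (univ : Finset (Fin d))) K : ℚ) by simp]
  rw [MvPolynomial.C_mul_monomial, MvPolynomial.coeff_monomial, ee_sum, multi_eq, hK.1]
  simp only [EmbeddingLike.apply_eq_iff_eq]
  split_ifs with h
  · rw [Finset.prod_product, Finset.prod_product, mul_left_comm]
    congr 1
    rw [div_mul_eq_mul_div, mul_div_assoc, ← Finset.prod_div_distrib]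
    congr 1
    refine Finset.prod_congr rfl fun l _ => ?_
    dsimp only
    rw [Finset.prod_pow_eq_pow_sum]
    simp only [cc, fct, wt, div_pow]
    push_cast
    rw [div_div, mul_comm]
  · simp


/-- The order-preserving embedding of multi-indices into a linear order realizing `mlt`. -/
def embLex {n : ℕ} (l : Fin n → ℕ) : ℕ ×ₗ Lex (Fin n → ℕ) := toLex (wt l, toLex l)

lemma embLex_inj {n : ℕ} : Function.Injective (embLex (n := n)) := by
  intro a b h
  have := congrArg (fun x => ofLex (ofLex x).2) h
  simpa [embLex] using this

lemma mlt_iff {n : ℕ} (a b : Fin n → ℕ) : mlt a b ↔ embLex a < embLex b := by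
  unfold mlt embLex
  rw [Prod.Lex.toLex_lt_toLex]
  rfl

lemma mlt_zero {n : ℕ} (a : Fin n → ℕ) : mlt 0 a ↔ 1 ≤ wt a := by
  constructor
  · rintro (h | ⟨h, k, -, hk⟩)
    · simp [wt] at h ⊢; omega
    · have : a k ≤ wt a := Finset.single_le_sum (f := a) (fun i _ => Nat.zero_le _) (mem_univ k)
      simp at hk; omega
  · intro h
    left
    have : wt (0 : Fin n → ℕ) = 0 := by simp [wt]
    omega

/-- The function attached to a pair of tuples. -/
def TT {d n s : ℕ} (p : (Fin s → Fin d → ℕ) × (Fin s → Fin n → ℕ)) : (Fin n → ℕ) × Fin d → ℕ :=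
  fun q => ∑ j, if p.2 j = q.1 then p.1 j q.2 else 0

lemma TT_apply {d n s : ℕ} (p : (Fin s → Fin d → ℕ) × (Fin s → Fin n → ℕ))
    (h : Function.Injective p.2) (j : Fin s) : (fun i => TT p (p.2 j, i)) = p.1 j := by
  ext i
  simp [TT, h.eq_iff]

lemma TT_out {d n s : ℕ} (p : (Fin s → Fin d → ℕ) × (Fin s → Fin n → ℕ))
    (l : Fin n → ℕ) (hl : ∀ j, p.2 j ≠ l) : (fun i => TT p (l, i)) = 0 := by
  ext i
  simp [TT, hl]

@[to_additive]
lemma TT_prod {β : Type*} [CommMonoid β] {d n s : ℕ} (p : (Fin s → Fin d → ℕ) × (Fin s → Fin n → ℕ))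
    (h : Function.Injective p.2) (L : Finset (Fin n → ℕ)) (hL : ∀ j, p.2 j ∈ L)
    (F : (Fin n → ℕ) → (Fin d → ℕ) → β) (hF : ∀ l, F l 0 = 1) :
    ∏ l ∈ L, F l (fun i => TT p (l, i)) = ∏ j, F (p.2 j) (p.1 j) := by
  classical
  have hs : univ.image p.2 ⊆ L := by
    intro l hl
    obtain ⟨j, -, rfl⟩ := Finset.mem_image.1 hl
    exact hL j
  rw [← Finset.prod_subset hs, Finset.prod_image (fun a _ b _ hab => h hab)]
  · exact Finset.prod_congr rfl fun j _ => by rw [TT_apply p h]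
  · intro l _ hl
    rw [TT_out, hF]
    intro j hj
    exact hl (Finset.mem_image.2 ⟨j, mem_univ _, hj⟩)

lemma wt_sum {ι : Type*} {m : ℕ} (S : Finset ι) (f : ι → Fin m → ℕ) :
    wt (∑ j ∈ S, f j) = ∑ j ∈ S, wt (f j) := by
  simp only [wt, Finset.sum_apply]
  exact Finset.sum_comm

lemma wt_pos {m : ℕ} (k : Fin m → ℕ) : 0 < wt k ↔ k ≠ 0 := by
  rw [Nat.pos_iff_ne_zero, not_iff_not, wt, Finset.sum_eq_zero_iff]
  simp [funext_iff]

def KS (d n s : ℕ) (ν : Fin n → ℕ) (lam : Fin d → ℕ) : Finset ((Fin n → ℕ) × Fin d → ℕ) :=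
  {K ∈ {K ∈ KK d n ν (wt lam) | ∑ l ∈ LL n (wt ν), (fun i => K (l, i)) = lam} |
    #{l ∈ LL n (wt ν) | (fun i => K (l, i)) ≠ 0} = s}

lemma mem_KS {d n s : ℕ} {ν : Fin n → ℕ} {lam : Fin d → ℕ} {K : (Fin n → ℕ) × Fin d → ℕ} :
    K ∈ KS d n s ν lam ↔ (∀ q, K q ≠ 0 → q.1 ∈ LL n (wt ν)) ∧
      ∑ l ∈ LL n (wt ν), (wt fun i => K (l, i)) • l = ν ∧
      ∑ l ∈ LL n (wt ν), (fun i => K (l, i)) = lam ∧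
      ∑ l ∈ LL n (wt ν), (if (fun i => K (l, i)) ≠ 0 then 1 else 0) = s := by
  rw [KS, Finset.mem_filter, Finset.mem_filter, KK, Finset.mem_filter, Finset.mem_piAntidiag,
    Finset.card_filter]
  constructor
  · rintro ⟨⟨⟨⟨_, h1⟩, h2⟩, h3⟩, h4⟩
    exact ⟨fun q hq => (Finset.mem_product.1 (h1 q hq)).1, h2, h3, h4⟩
  · rintro ⟨h1, h2, h3, h4⟩
    refine ⟨⟨⟨⟨?_, fun q hq => Finset.mem_product.2 ⟨h1 q hq, mem_univ _⟩⟩, h2⟩, h3⟩, h4⟩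
    rw [← h3, wt_sum, Finset.sum_product]
    rfl

lemma Ps_inj {d n s : ℕ} {ν : Fin n → ℕ} {lam : Fin d → ℕ}
    {p : (Fin s → Fin d → ℕ) × (Fin s → Fin n → ℕ)} (hp : p ∈ PsSet n d s ν lam) :
    StrictMono (embLex ∘ p.2) := fun a b hab => (mlt_iff _ _).1 (hp.2.2.2.1 a b hab)

lemma Ps_LL {d n s : ℕ} {ν : Fin n → ℕ} {lam : Fin d → ℕ}
    {p : (Fin s → Fin d → ℕ) × (Fin s → Fin n → ℕ)} (hp : p ∈ PsSet n d s ν lam) (j : Fin s) :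
    p.2 j ∈ LL n (wt ν) := by
  obtain ⟨h1, h2, h3, h4, h5⟩ := hp
  refine mem_LL.2 ⟨(mlt_zero _).1 (h3 j), ?_⟩
  rw [← h5, wt_sum]
  refine le_trans ?_ (Finset.single_le_sum (f := fun j => wt (wt (p.1 j) • p.2 j)) (fun i _ => Nat.zero_le _) (mem_univ j))
  simp only [wt, Pi.smul_apply, smul_eq_mul]
  refine Finset.sum_le_sum fun i _ => ?_
  exact Nat.le_mul_of_pos_left _ (h1 j)

lemma bij (d n s : ℕ) (ν : Fin n → ℕ) (lam : Fin d → ℕ) :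
    Set.BijOn TT (PsSet n d s ν lam) (KS d n s ν lam : Set ((Fin n → ℕ) × Fin d → ℕ)) := by
  classical
  refine ⟨?_, ?_, ?_⟩
  · intro p hp
    have hinj : Function.Injective p.2 := (Ps_inj hp).injective.of_comp
    have hL := Ps_LL hp
    rw [Finset.mem_coe, mem_KS]
    obtain ⟨h1, h2, h3, h4, h5⟩ := hp
    refine ⟨?_, ?_, ?_, ?_⟩
    · intro q hq
      by_contra hc
      apply hq
      have := TT_out p q.1 (fun j hj => hc (hj ▸ hL j))
      exact congrFun this q.2
    · rw [TT_sum p hinj _ hL (fun l k => wt k • l) (by simp [wt])]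
      exact h5
    · rw [TT_sum p hinj _ hL (fun l k => k) (by simp)]
      exact h2
    · rw [TT_sum p hinj _ hL (fun l k => if k ≠ 0 then 1 else 0) (by simp)]
      rw [Finset.sum_congr rfl fun j _ => if_pos ((wt_pos _).1 (h1 j))]
      simp
  · intro p hp p' hp' hT
    have key : ∀ p ∈ PsSet n d s ν lam, Set.range p.2 = {l | (fun i => TT p (l, i)) ≠ 0} := by
      intro p hp
      have hinj : Function.Injective p.2 := (Ps_inj hp).injective.of_comp
      ext l
      constructor
      · rintro ⟨j, rfl⟩
        rw [Set.mem_ofPred_eq, TT_apply p hinj]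
        exact (wt_pos _).1 (hp.1 j)
      · intro h
        by_contra hc
        exact h (TT_out p l fun j hj => hc ⟨j, hj⟩)
    have hr : Set.range p.2 = Set.range p'.2 := by rw [key p hp, key p' hp', hT]
    have h2 : embLex ∘ p.2 = embLex ∘ p'.2 := by
      rw [← StrictMono.range_inj (Ps_inj hp) (Ps_inj hp'), Set.range_comp, Set.range_comp, hr]
    have h2' : p.2 = p'.2 := embLex_inj.comp_left h2
    refine Prod.ext ?_ h2'
    funext j
    rw [← TT_apply p (Ps_inj hp).injective.of_comp j, ← TT_apply p' (Ps_inj hp').injective.of_comp j, hT, h2']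
  · intro K hK
    rw [Finset.mem_coe, mem_KS] at hK
    obtain ⟨h1, h2, h3, h4⟩ := hK
    rw [← Finset.card_filter] at h4
    set S := {l ∈ LL n (wt ν) | (fun i => K (l, i)) ≠ 0} with hS
    have hc : (S.image embLex).card = s := by rw [Finset.card_image_of_injective _ embLex_inj, h4]
    have hex : ∀ j : Fin s, ∃ l ∈ S, embLex l = (S.image embLex).orderEmbOfFin hc j := fun j =>
      Finset.mem_image.1 (Finset.orderEmbOfFin_mem _ hc j)
    choose l hlS hl using hex
    have hmono : StrictMono (embLex ∘ l) := by
      intro a b hab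
      simp only [Function.comp, hl]
      exact (OrderEmbedding.strictMono _) hab
    have hinj : Function.Injective l := hmono.injective.of_comp
    have hsur : ∀ x ∈ S, ∃ j, l j = x := by
      intro x hx
      have : embLex x ∈ Set.range ((S.image embLex).orderEmbOfFin hc) := by
        rw [Finset.range_orderEmbOfFin]
        exact Finset.mem_coe.2 (Finset.mem_image_of_mem _ hx)
      obtain ⟨j, hj⟩ := this
      exact ⟨j, embLex_inj ((hl j).trans hj)⟩
    set p : (Fin s → Fin d → ℕ) × (Fin s → Fin n → ℕ) := (fun j i => K (l j, i), l) with hp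
    have hTT : TT p = K := by
      funext q
      obtain ⟨x, i⟩ := q
      by_cases hx : x ∈ S
      · obtain ⟨j, rfl⟩ := hsur x hx
        exact congrFun (TT_apply p hinj j) i
      · have e1 := congrFun (TT_out p x (fun j hj => hx (hj ▸ hlS j))) i
        simp only [Pi.zero_apply] at e1
        rw [e1]
        by_contra hK
        apply hx
        rw [hS, Finset.mem_filter]
        exact ⟨h1 _ (Ne.symm hK), fun h => hK (congrFun h i).symm⟩
    have hL : ∀ j, p.2 j ∈ LL n (wt ν) := fun j => (Finset.mem_filter.1 (hlS j)).1
    refine ⟨p, ⟨?_, ?_, ?_, ?_, ?_⟩, hTT⟩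
    · intro j
      exact (wt_pos _).2 (Finset.mem_filter.1 (hlS j)).2
    · rw [← TT_sum p hinj _ hL (fun l k => k) (by simp), hTT]
      exact h3
    · intro j
      exact (mlt_zero _).2 (mem_LL.1 (hL j)).1
    · intro j j' hj
      exact (mlt_iff _ _).2 (hmono hj)
    · rw [← TT_sum p hinj _ hL (fun l k => wt k • l) (by simp [wt]), hTT]
      exact h2

def wgt {d n : ℕ} (ν : Fin n → ℕ) (K : (Fin n → ℕ) × Fin d → ℕ) : ℚ :=
  (fct ν : ℚ) * ∏ l ∈ LL n (wt ν),
      (((wt l).factorial : ℚ) ^ (wt fun i => K (l, i)) /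
        ((fct fun i => K (l, i) : ℚ) * (fct l : ℚ) ^ (wt fun i => K (l, i))))

lemma innerPs_sum (d n s : ℕ) (ν : Fin n → ℕ) (lam : Fin d → ℕ) :
    (∑ᶠ p ∈ PsSet n d s ν lam,
              (fct ν : ℚ) *
                ∏ j, ((wt (p.2 j)).factorial : ℚ) ^ (wt (p.1 j)) /
                  ((fct (p.1 j) : ℚ) * ((fct (p.2 j) : ℚ)) ^ (wt (p.1 j))))
      = ∑ K ∈ KS d n s ν lam, wgt ν K := by
  rw [← finsum_mem_coe_finset]
  refine finsum_mem_eq_of_bijOn TT (bij d n s ν lam) ?_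
  intro p hp
  rw [wgt, TT_prod p (Ps_inj hp).injective.of_comp _ (Ps_LL hp) (fun l k => ((wt l).factorial : ℚ) ^ (wt k) /
        ((fct k : ℚ) * (fct l : ℚ) ^ (wt k)))]
  intro l
  simp [wt, fct]

set_option maxHeartbeats 1000000 in
lemma fixed_N (d n N : ℕ) (ν : Fin n → ℕ) (h1 : 1 ≤ N) (h2 : N ≤ wt ν) :
    ∑ lam ∈ piAntidiag (univ : Finset (Fin d)) N, ((wt lam).factorial : ℚ) *
      ∑ s ∈ Icc 1 (wt ν), ∑ K ∈ KS d n s ν lam, wgt ν K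
    = ∑ K ∈ KK d n ν N, (N.factorial : ℚ) * wgt ν K := by
  classical
  have hmap : ∀ K ∈ KK d n ν N, ∑ l ∈ LL n (wt ν), (fun i => K (l, i)) ∈ piAntidiag (univ : Finset (Fin d)) N := by
    intro K hK
    rw [KK, Finset.mem_filter, Finset.mem_piAntidiag, Finset.sum_product] at hK
    rw [Finset.mem_piAntidiag]
    refine ⟨?_, by simp⟩
    have := wt_sum (LL n (wt ν)) (fun l i => K (l, i))
    simp only [wt] at this hK ⊢
    rw [this]
    exact hK.1.1
  rw [← Finset.sum_fiberwise_of_maps_to hmap]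
  refine Finset.sum_congr rfl fun lam hlam => ?_
  have hw : wt lam = N := (Finset.mem_piAntidiag.1 hlam).1
  rw [← Finset.mul_sum, hw]
  congr 1
  have hmap2 : ∀ K ∈ {K ∈ KK d n ν N | ∑ l ∈ LL n (wt ν), (fun i => K (l, i)) = lam},
      #{l ∈ LL n (wt ν) | (fun i => K (l, i)) ≠ 0} ∈ Icc 1 (wt ν) := by
    intro K hK
    have hK := (Finset.mem_filter.1 hK).1
    rw [KK, Finset.mem_filter, Finset.mem_piAntidiag, Finset.sum_product] at hK
    have hs := hK.1.1
    rw [Finset.mem_Icc]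
    constructor
    · rw [Nat.one_le_iff_ne_zero]
      intro h0
      rw [Finset.card_eq_zero, Finset.filter_eq_empty_iff] at h0
      rw [Finset.sum_eq_zero] at hs
      · omega
      · intro l hl
        have := h0 hl
        rw [not_not] at this
        exact Finset.sum_eq_zero fun i _ => congrFun this i
    · refine le_trans ?_ h2
      rw [← hs, Finset.card_filter]
      refine Finset.sum_le_sum fun l _ => ?_
      split_ifs with h
      · exact (wt_pos _).2 h
      · exact Nat.zero_le _
  rw [← Finset.sum_fiberwise_of_maps_to hmap2]
  refine Finset.sum_congr rfl fun s _ => ?_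
  rw [KS, hw]

end AA

theorem stmt15 (d n : ℕ) (hd : 1 ≤ d) (hn : 1 ≤ n) (ν : Fin n → ℕ) (hν : ν ≠ 0) :
    (∑ᶠ lam ∈ {l : Fin d → ℕ | 1 ≤ wt l ∧ wt l ≤ wt ν},
        ((wt lam).factorial : ℚ) *
          ∑ s ∈ Finset.Icc 1 (wt ν),
            ∑ᶠ p ∈ PsSet n d s ν lam,
              (fct ν : ℚ) *
                ∏ j, ((wt (p.2 j)).factorial : ℚ) ^ (wt (p.1 j)) /
                  ((fct (p.1 j) : ℚ) * ((fct (p.2 j) : ℚ)) ^ (wt (p.1 j))))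
      = (d : ℚ) * ((d : ℚ) + 1) ^ (wt ν - 1) * ((wt ν).factorial : ℚ) := by
  classical
  have hw : 1 ≤ wt ν := (wt_pos ν).2 hν
  have hS : {l : Fin d → ℕ | 1 ≤ wt l ∧ wt l ≤ wt ν} = (LL d (wt ν) : Set (Fin d → ℕ)) := by
    ext l
    simp [mem_LL]
  rw [hS, finsum_mem_coe_finset, sum_LL]
  simp only [innerPs_sum]
  rw [Finset.sum_congr rfl fun N hN => fixed_N d n N ν (Finset.mem_Icc.1 hN).1 (Finset.mem_Icc.1 hN).2]
  simp only [wgt, KK_sum]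
  rw [← Finset.mul_sum, ← MvPolynomial.coeff_sum, gen d n ν hw, cc]
  have := fct_ne ν
  field_simp
end
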